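/- Let s ∈ ℕ, let G be a finite abelian group, let I be a finite nonempty indexing set, and for each i ∈ I let H_i, K_{i1}, …, K_{is} be subgroups of G. Then for every 1-bounded function f : G → ℂ, ( E_{i∈I} ‖f‖_{H_i, K_{i1}, …, K_{is}}^{2^{s+1}} )^{2^{2s+1}} ≤ E_{i,i'∈I} ‖f‖_{K_{i1}, …, K_{is}, K_{i'1}, …, K_{i's}, H_i + H_{i'}}^{2^{2s+1}}. -/

import Mathlib

open Finset Polynomial
open scoped BigOperators

noncomputable section


/-- The average of a complex-valued function over a finite type. -/
def eavg {α : Type*} [Finite α] (f : α → ℂ) : ℂ :=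
  haveI := Fintype.ofFinite α
  (∑ x, f x) / (Nat.card α : ℂ)

/-- The average of a real-valued function over a finite type. -/
def eavgR {α : Type*} [Finite α] (f : α → ℝ) : ℝ :=
  haveI := Fintype.ofFinite α
  (∑ x, f x) / (Nat.card α : ℝ)

/-- Iterated complex conjugation `C^n`. -/
def conjIter (n : ℕ) (z : ℂ) : ℂ := if Even n then z else (starRingEnd ℂ) z

/-- The weight `|ε|` of a Boolean vector. -/
def epsWt {ι : Type*} [Finite ι] (ε : ι → Bool) : ℕ :=
  haveI := Fintype.ofFinite ι
  ∑ i, if ε i then 1 else 0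

/-- The Gowers box norm of `f` along a finite family of subgroups of `G`. -/
def boxNorm {G : Type*} [AddCommGroup G] [Finite G] {ι : Type*} [Finite ι]
    (H : ι → AddSubgroup G) (f : G → ℂ) : ℝ :=
  haveI := Fintype.ofFinite ι
  haveI : Fintype (ι → Bool) := Fintype.ofFinite _
  ((eavg fun x : G => eavg fun h : ∀ i, H i =>
      ∏ ε : ι → Bool,
        conjIter (epsWt ε) (f (x + ∑ i, if ε i then (h i : G) else 0))).re) ^
    ((1 : ℝ) / 2 ^ Nat.card ι)

/-- Reduction of an integer vector modulo `p`. -/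
def redv (p : ℕ) {D : ℕ} (w : Fin D → ℤ) : Fin D → ZMod p := fun k => (w k : ZMod p)

/-- The vector `v·P(n)` in `F_p^D`. -/
def pshift (p : ℕ) {D : ℕ} (v : Fin D → ℤ) (P : Polynomial ℤ) (n : ZMod p) :
    Fin D → ZMod p :=
  fun k => (v k : ZMod p) * Polynomial.aeval n P

/-- The Gowers norm of degree `s` of `f` along the direction `v`. -/
def gowersU (p : ℕ) [NeZero p] {D : ℕ} (s : ℕ) (v : Fin D → ℤ)
    (f : (Fin D → ZMod p) → ℂ) : ℝ :=
  (eavg fun x : Fin D → ZMod p => eavg fun h : Fin s → ZMod p =>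
      ∏ ε : Fin s → Bool,
        conjIter (epsWt ε)
          (f (x + fun k => (∑ i, if ε i then h i else 0) * (v k : ZMod p)))).re ^
    ((1 : ℝ) / 2 ^ s)

/-- The conditional expectation `E(f | v)`. -/
def condAvg (p : ℕ) [NeZero p] {D : ℕ} (v : Fin D → ℤ)
    (f : (Fin D → ZMod p) → ℂ) (x : Fin D → ZMod p) : ℂ :=
  eavg fun n : ZMod p => f (x + fun k => n * (v k : ZMod p))

/-- The additive character `e_p`. -/
def ep (p : ℕ) (t : ZMod p) : ℂ :=
  Complex.exp (2 * Real.pi * Complex.I * (t.val : ℂ) / (p : ℂ))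

/-- `χ` is an eigenfunction of the direction `v`. -/
def IsEigenfunction (p : ℕ) {D : ℕ} (v : Fin D → ℤ) (χ : (Fin D → ZMod p) → ℂ) : Prop :=
  ∃ φ : (Fin D → ZMod p) → ZMod p,
    (∀ x, ‖χ x‖ = 0 ∨ ‖χ x‖ = 1) ∧
    (∀ x, χ (x + redv p v) = ep p (φ x) * χ x) ∧
    (∀ x, φ (x + redv p v) = φ x)

/-- The degree-`s'` dual function of `g` along `v`. -/
def dualFn (p : ℕ) [NeZero p] {D : ℕ} (s' : ℕ) (v : Fin D → ℤ)
    (g : (Fin D → ZMod p) → ℂ) (x : Fin D → ZMod p) : ℂ :=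
  eavg fun h : Fin s' → ZMod p =>
    ∏ ε ∈ Finset.univ.filter (fun ε : Fin s' → Bool => ε ≠ fun _ => false),
      conjIter (epsWt ε)
        (g (x + fun k => (∑ i, if ε i then h i else 0) * (v k : ZMod p)))

/-- Membership in `𝔇_s(v)`. -/
def MemDual (p : ℕ) [NeZero p] {D : ℕ} (s : ℕ) (v : Fin D → ℤ)
    (Df : (Fin D → ZMod p) → ℂ) : Prop :=
  ∃ (s' : ℕ) (g : (Fin D → ZMod p) → ℂ),
    1 ≤ s' ∧ s' ≤ s ∧ (∀ x, ‖g x‖ ≤ 1) ∧ Df = dualFn p s' v g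

theorem eavg_eq_expect {α : Type*} [Fintype α] (f : α → ℂ) : eavg f = 𝔼 x, f x := by
  rw [Fintype.expect_eq_sum_div_card, eavg, Nat.card_eq_fintype_card]
  congr!

theorem eavgR_eq_expect {α : Type*} [Fintype α] (f : α → ℝ) : eavgR f = 𝔼 x, f x := by
  rw [Fintype.expect_eq_sum_div_card, eavgR, Nat.card_eq_fintype_card]
  congr!

theorem eavg_comp_equiv {α β : Type*} [Finite α] [Finite β] (e : α ≃ β) (f : β → ℂ) :
    (eavg fun x => f (e x)) = eavg f := by
  have := Fintype.ofFinite α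
  have := Fintype.ofFinite β
  simp only [eavg_eq_expect]
  exact Fintype.expect_equiv e _ _ fun _ => rfl

theorem eavg_prod {α β : Type*} [Finite α] [Finite β] (f : α × β → ℂ) :
    eavg f = eavg fun x => eavg fun y => f (x, y) := by
  have := Fintype.ofFinite α
  have := Fintype.ofFinite β
  simp only [eavg_eq_expect]
  exact Finset.expect_product univ univ f

theorem eavg_comm {α β : Type*} [Finite α] [Finite β] (f : α → β → ℂ) :
    (eavg fun x => eavg fun y => f x y) = eavg fun y => eavg fun x => f x y := by
  have := Fintype.ofFinite α
  have := Fintype.ofFinite β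
  simp only [eavg_eq_expect]
  exact Finset.expect_comm _ _ _

theorem mul_eavg {α : Type*} [Finite α] (a : ℂ) (f : α → ℂ) :
    a * eavg f = eavg fun x => a * f x := by
  have := Fintype.ofFinite α
  simp only [eavg_eq_expect, Finset.mul_expect]

theorem eavg_mul {α : Type*} [Finite α] (a : ℂ) (f : α → ℂ) :
    eavg f * a = eavg fun x => f x * a := by
  have := Fintype.ofFinite α
  simp only [eavg_eq_expect, Finset.expect_mul]

theorem eavg_const {α : Type*} [Finite α] [Nonempty α] (a : ℂ) :
    (eavg fun _ : α => a) = a := by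
  have := Fintype.ofFinite α
  simp only [eavg_eq_expect, Fintype.expect_const]

theorem conj_eavg {α : Type*} [Finite α] (f : α → ℂ) :
    starRingEnd ℂ (eavg f) = eavg fun x => starRingEnd ℂ (f x) := by
  simp [eavg]

theorem ofReal_eavgR {α : Type*} [Finite α] (f : α → ℝ) :
    ((eavgR f : ℝ) : ℂ) = eavg fun x => (f x : ℂ) := by
  simp [eavg, eavgR]

theorem eavgR_nonneg {α : Type*} [Finite α] {f : α → ℝ} (hf : ∀ x, 0 ≤ f x) : 0 ≤ eavgR f := by
  have := Fintype.ofFinite α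
  rw [eavgR_eq_expect]
  exact Finset.expect_nonneg fun x _ => hf x

theorem eavgR_mono {α : Type*} [Finite α] {f g : α → ℝ} (h : ∀ x, f x ≤ g x) :
    eavgR f ≤ eavgR g := by
  have := Fintype.ofFinite α
  simp only [eavgR_eq_expect]
  exact Finset.expect_le_expect fun x _ => h x

theorem norm_eavg_le {α : Type*} [Finite α] (f : α → ℂ) : ‖eavg f‖ ≤ eavgR fun x => ‖f x‖ := by
  have := Fintype.ofFinite α
  simp only [eavgR_eq_expect, eavg_eq_expect]
  exact RCLike.norm_expect_le (K := ℂ)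

theorem eavgR_pow_le {α : Type*} [Finite α] [Nonempty α] {f : α → ℝ} (hf : ∀ x, 0 ≤ f x) (n : ℕ) :
    eavgR f ^ n ≤ eavgR fun x => f x ^ n := by
  have := Fintype.ofFinite α
  have h := Real.pow_arith_mean_le_arith_mean_pow univ (fun _ : α => (Fintype.card α : ℝ)⁻¹) f
    (fun _ _ => by positivity) (by simp) (fun x _ => hf x) n
  simpa only [eavgR_eq_expect, Fintype.expect_eq_sum_div_card, inv_mul_eq_div,
    ← Finset.sum_div] using h

/-- Averaging over a finite group commutes with a surjective homomorphism. -/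
theorem eavg_comp_surjective {A B : Type*} [AddGroup A] [AddGroup B] [Finite A] [Finite B]
    (φ : A →+ B) (hφ : Function.Surjective φ) (f : B → ℂ) :
    (eavg fun a => f (φ a)) = eavg f := by
  have key : ∀ b : B, (eavg fun a => f (φ a)) = eavg fun a => f (φ a + b) := by
    intro b
    obtain ⟨c, rfl⟩ := hφ b
    rw [← eavg_comp_equiv (Equiv.addRight c)]
    simp
  rw [← eavg_const (α := B) (eavg fun a => f (φ a)), funext key, eavg_comm]
  conv_lhs =>
    enter [1, a]
    rw [show (fun b => f (φ a + b)) = fun b => f (Equiv.addLeft (φ a) b) from rfl,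
      eavg_comp_equiv]
  exact eavg_const _

/-- The Cauchy-Schwarz inequality, eliminating a bounded weight. -/
theorem sq_norm_eavg_mul_le {α : Type*} [Finite α] [Nonempty α] {a : α → ℂ}
    (ha : ∀ x, ‖a x‖ ≤ 1) (b : α → ℂ) :
    ‖eavg fun x => a x * b x‖ ^ 2 ≤ ‖eavg fun x => b x * starRingEnd ℂ (b x)‖ := by
  have h₁ : ‖eavg fun x => a x * b x‖ ≤ eavgR fun x => ‖b x‖ := by
    refine (norm_eavg_le _).trans (eavgR_mono fun x => ?_)
    rw [norm_mul]
    exact mul_le_of_le_one_left (norm_nonneg _) (ha x)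
  have h₂ : (eavg fun x => b x * starRingEnd ℂ (b x)) = ((eavgR fun x => ‖b x‖ ^ 2 : ℝ) : ℂ) := by
    simp [ofReal_eavgR, Complex.mul_conj']
  rw [h₂, Complex.norm_real, Real.norm_of_nonneg (eavgR_nonneg fun _ => by positivity)]
  exact (pow_le_pow_left₀ (norm_nonneg _) h₁ 2).trans
    (eavgR_pow_le (fun _ => norm_nonneg _) 2)

/-- Expanding `|E b|²` as a double average. -/
theorem eavg_mul_conj_eavg {α β : Type*} [Finite α] [Finite β] (b : α → ℂ) (c : β → ℂ) :
    eavg b * starRingEnd ℂ (eavg c) =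
      eavg fun p : α × β => b p.1 * starRingEnd ℂ (c p.2) := by
  simp only [eavg_prod, conj_eavg, mul_eavg, eavg_mul]
  exact eavg_comm _

theorem conjIter_mul (n : ℕ) (a b : ℂ) : conjIter n (a * b) = conjIter n a * conjIter n b := by
  unfold conjIter; split_ifs <;> simp

theorem conjIter_succ (n : ℕ) (a : ℂ) : conjIter (n + 1) a = conjIter n (starRingEnd ℂ a) := by
  unfold conjIter; split_ifs with h₁ h₂ h₂ <;> simp_all [Nat.even_add_one]

theorem conjIter_conj (n : ℕ) (a : ℂ) :
    conjIter n (starRingEnd ℂ a) = starRingEnd ℂ (conjIter n a) := by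
  unfold conjIter; split_ifs <;> simp

theorem norm_conjIter (n : ℕ) (a : ℂ) : ‖conjIter n a‖ = ‖a‖ := by
  unfold conjIter; split_ifs <;> simp

theorem epsWt_eq_sum {ι : Type*} [Fintype ι] (ε : ι → Bool) :
    epsWt ε = ∑ i, if ε i then 1 else 0 := by
  unfold epsWt; congr!

section BoxProduct

variable {G : Type*} [AddCommGroup G]

/-- The product of `f` and its conjugates over the vertices of the box based at `x`
with edges `h`. -/
def boxProd {ι : Type*} [Finite ι] (f : G → ℂ) (x : G) (h : ι → G) : ℂ :=
  haveI := Fintype.ofFinite ι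
  haveI : Fintype (ι → Bool) := Fintype.ofFinite _
  ∏ ε : ι → Bool, conjIter (epsWt ε) (f (x + ∑ i, if ε i then h i else 0))

/-- The multiplicative derivative of `f` in the direction `a`. -/
def mulDeriv (a : G) (f : G → ℂ) (x : G) : ℂ := f x * starRingEnd ℂ (f (x + a))

theorem boxProd_eq_prod {ι : Type*} [Fintype ι] [Fintype (ι → Bool)] (f : G → ℂ) (x : G)
    (h : ι → G) :
    boxProd f x h =
      ∏ ε : ι → Bool, conjIter (epsWt ε) (f (x + ∑ i, if ε i then h i else 0)) := by
  unfold boxProd; congr!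

theorem boxProd_of_isEmpty {ι : Type*} [Finite ι] [IsEmpty ι] (f : G → ℂ) (x : G) (h : ι → G) :
    boxProd f x h = f x := by
  have := Fintype.ofFinite ι
  have := Fintype.ofFinite (ι → Bool)
  simp [boxProd_eq_prod, epsWt_eq_sum, conjIter]

theorem boxProd_mul {ι : Type*} [Finite ι] (f g : G → ℂ) (x : G) (h : ι → G) :
    boxProd (fun y => f y * g y) x h = boxProd f x h * boxProd g x h := by
  simp [boxProd, conjIter_mul, Finset.prod_mul_distrib]

theorem boxProd_conj {ι : Type*} [Finite ι] (f : G → ℂ) (x : G) (h : ι → G) :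
    boxProd (fun y => starRingEnd ℂ (f y)) x h = starRingEnd ℂ (boxProd f x h) := by
  simp [boxProd, conjIter_conj]

theorem boxProd_translate {ι : Type*} [Finite ι] (a : G) (f : G → ℂ) (x : G) (h : ι → G) :
    boxProd (fun y => f (y + a)) x h = boxProd f (x + a) h := by
  simp [boxProd, add_right_comm]

theorem boxProd_mulDeriv {ι : Type*} [Finite ι] (a : G) (f : G → ℂ) (x : G) (h : ι → G) :
    boxProd (mulDeriv a f) x h = boxProd f x h * starRingEnd ℂ (boxProd f (x + a) h) := by
  rw [← boxProd_translate, ← boxProd_conj, ← boxProd_mul]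
  rfl

theorem boxProd_comp_equiv {α β : Type*} [Finite α] [Finite β] (e : α ≃ β) (f : G → ℂ) (x : G)
    (h : β → G) : boxProd f x (fun a => h (e a)) = boxProd f x h := by
  classical
  have := Fintype.ofFinite α
  have := Fintype.ofFinite β
  simp only [boxProd_eq_prod, epsWt_eq_sum]
  refine Fintype.prod_equiv (e.arrowCongr (Equiv.refl Bool)) _ _ fun ε => ?_
  congr 1
  · exact Fintype.sum_equiv e _ _ (by simp)
  · congr 2
    exact Fintype.sum_equiv e _ _ (by simp)

theorem boxProd_option {ι : Type*} [Finite ι] (f : G → ℂ) (x : G) (h : Option ι → G) :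
    boxProd f x h = boxProd (mulDeriv (h none) f) x fun i => h (some i) := by
  classical
  have := Fintype.ofFinite ι
  simp only [boxProd_eq_prod, epsWt_eq_sum]
  rw [Fintype.prod_equiv (Equiv.piOptionEquivProd (β := fun _ : Option ι => Bool)) _
    (fun p => conjIter ((if p.1 then 1 else 0) + ∑ i, if p.2 i then 1 else 0)
      (f (x + ((if p.1 then h none else 0) + ∑ i, if p.2 i then h (some i) else 0))))
    fun ε => by simp only [Fintype.sum_option]; rfl]
  rw [Fintype.prod_prod_type, Fintype.prod_bool, mul_comm, ← Finset.prod_mul_distrib]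
  refine Finset.prod_congr rfl fun ε _ => ?_
  rw [mulDeriv, conjIter_mul]
  congr 1
  · simp
  · rw [if_pos rfl, if_pos rfl, add_comm 1, conjIter_succ, add_comm (h none), add_assoc]

theorem eavg_add_right {K : Type*} [AddGroup K] [Finite K] (a : K) (f : K → ℂ) :
    (eavg fun x => f (x + a)) = eavg f :=
  eavg_comp_equiv (Equiv.addRight a) f

theorem eavg_sub_right {K : Type*} [AddGroup K] [Finite K] (a : K) (f : K → ℂ) :
    (eavg fun x => f (x - a)) = eavg f :=
  eavg_comp_equiv (Equiv.subRight a) f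

theorem eavg_sub_eq_eavg_sup [Finite G] (H H' : AddSubgroup G) (f : G → ℂ) :
    (eavg fun u : H × H' => f (u.1 - u.2)) = eavg fun w : ↥(H ⊔ H') => f w := by
  let φ : H × H' →+ ↥(H ⊔ H') := AddMonoidHom.coprod
    (AddSubgroup.inclusion le_sup_left) (-(AddSubgroup.inclusion le_sup_right))
  refine Eq.trans ?_ (eavg_comp_surjective φ ?_ fun w => f w)
  · congr! 3 with u
    simp [φ, sub_eq_add_neg]
  · rintro ⟨w, hw⟩
    obtain ⟨a, ha, b, hb, rfl⟩ := AddSubgroup.mem_sup.1 hw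
    exact ⟨(⟨a, ha⟩, ⟨-b, neg_mem hb⟩), Subtype.ext (by simp [φ])⟩

/-- The autocorrelation of a function along a subgroup is non-negative. -/
theorem eavg_mul_conj_add [Finite G] (H : AddSubgroup G) (A : G → ℂ) :
    (eavg fun x => eavg fun w : H => A x * starRingEnd ℂ (A (x + w))) =
      ((eavgR fun x => ‖eavg fun w : H => A (x + w)‖ ^ 2 : ℝ) : ℂ) := by
  have key : ∀ w : H, (eavg fun x => eavg fun v : H => A (x + w) * starRingEnd ℂ (A (x + v))) =
      eavg fun x => eavg fun v : H => A x * starRingEnd ℂ (A (x + v)) := by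
    intro w
    symm
    rw [← eavg_add_right (w : G)]
    refine congrArg eavg (funext fun x => ?_)
    symm
    rw [← eavg_add_right w]
    simp only [AddSubgroup.coe_add, add_assoc, add_comm (w : G)]
  simp only [ofReal_eavgR, Complex.ofReal_pow, ← Complex.mul_conj', eavg_mul_conj_eavg, eavg_prod]
  symm
  rw [eavg_comm]
  simp only [key, eavg_const]

theorem boxAvg_option [Finite G] {ι : Type*} [Finite ι] (H : Option ι → AddSubgroup G) (f : G → ℂ) :
    (eavg fun x : G => eavg fun h : ∀ i, H i => boxProd f x fun i => (h i : G)) =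
      eavg fun x : G => eavg fun w : H none => eavg fun h : ∀ i, H (some i) =>
        boxProd (mulDeriv (w : G) f) x fun i => (h i : G) := by
  refine congrArg eavg (funext fun x => ?_)
  rw [← eavg_comp_equiv (Equiv.piOptionEquivProd (β := fun o => H o)).symm, eavg_prod]
  simp only [boxProd_option]
  rfl

theorem boxAvg_option_nonneg [Finite G] {ι : Type*} [Finite ι] (H : Option ι → AddSubgroup G)
    (f : G → ℂ) : ∃ r : ℝ, 0 ≤ r ∧
      (eavg fun x : G => eavg fun h : ∀ i, H i => boxProd f x fun i => (h i : G)) = r := by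
  refine ⟨eavgR fun h : ∀ i, H (some i) => eavgR fun x =>
    ‖eavg fun w : H none => boxProd f (x + w) fun i => (h i : G)‖ ^ 2,
    eavgR_nonneg fun _ => eavgR_nonneg fun _ => by positivity, ?_⟩
  rw [boxAvg_option, ofReal_eavgR]
  have key := fun h : ∀ i, H (some i) => eavg_mul_conj_add (H none) fun x =>
    boxProd f x fun i => (h i : G)
  simp only [← key, boxProd_mulDeriv]
  simp only [eavg_comm (α := H none)]
  rw [eavg_comm]

theorem boxNorm_option_pow [Finite G] {ι : Type*} [Finite ι] (H : Option ι → AddSubgroup G)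
    (f : G → ℂ) :
    boxNorm H f ^ 2 ^ Nat.card (Option ι) =
      ‖eavg fun x : G => eavg fun h : ∀ i, H i => boxProd f x fun i => (h i : G)‖ := by
  obtain ⟨r, hr, h⟩ := boxAvg_option_nonneg H f
  rw [h, Complex.norm_real, Real.norm_of_nonneg hr]
  have : boxNorm H f = r ^ ((1 : ℝ) / 2 ^ Nat.card (Option ι)) := by
    rw [← Complex.ofReal_re r, ← h]
    rfl
  rw [this, ← Real.rpow_natCast, ← Real.rpow_mul hr]
  simp

/-- A function of several variables is a mixed product if it is a product of bounded functions,
one for each variable, that do not depend on the respective variable. -/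
def IsMixedProduct {ι : Type*} [Fintype ι] {α : ι → Type*} (g : (∀ i, α i) → ℂ) : Prop :=
  ∃ b : ι → (∀ i, α i) → ℂ, (∀ j k, ‖b j k‖ ≤ 1) ∧
    (∀ j k k', (∀ i, i ≠ j → k i = k' i) → b j k = b j k') ∧ ∀ k, g k = ∏ j, b j k

namespace IsMixedProduct

variable {ι : Type*} [Fintype ι] {α : ι → Type*}

theorem one : IsMixedProduct fun _ : ∀ i, α i => 1 :=
  ⟨fun _ _ => 1, by simp, by simp, by simp⟩

theorem mul {f g : (∀ i, α i) → ℂ} (hf : IsMixedProduct f) (hg : IsMixedProduct g) :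
    IsMixedProduct fun k => f k * g k := by
  obtain ⟨a, ha, ha', hfa⟩ := hf
  obtain ⟨b, hb, hb', hgb⟩ := hg
  refine ⟨fun j k => a j k * b j k, fun j k => ?_, fun j k k' h => ?_, fun k => ?_⟩
  · rw [norm_mul]
    exact mul_le_one₀ (ha j k) (norm_nonneg _) (hb j k)
  · simp only [ha' j k k' h, hb' j k k' h]
  · simp only [hfa, hgb, Finset.prod_mul_distrib]

theorem conj {f : (∀ i, α i) → ℂ} (hf : IsMixedProduct f) :
    IsMixedProduct fun k => starRingEnd ℂ (f k) := by
  obtain ⟨a, ha, ha', hfa⟩ := hf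
  refine ⟨fun j k => starRingEnd ℂ (a j k), by simpa using ha, fun j k k' h => ?_, fun k => ?_⟩
  · simp only [ha' j k k' h]
  · simp only [hfa, map_prod]

theorem prod {κ : Type*} (t : Finset κ) {f : κ → (∀ i, α i) → ℂ}
    (hf : ∀ c ∈ t, IsMixedProduct (f c)) : IsMixedProduct fun k => ∏ c ∈ t, f c k := by
  classical
  induction t using Finset.induction_on with
  | empty => simpa using one
  | insert c t hc ih =>
    simp only [Finset.prod_insert hc]
    exact (hf c (Finset.mem_insert_self _ _)).mul
      (ih fun d hd => hf d (Finset.mem_insert_of_mem hd))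

theorem of_independent {f : (∀ i, α i) → ℂ} (hf : ∀ k, ‖f k‖ ≤ 1) (j : ι)
    (hj : ∀ k k', (∀ i, i ≠ j → k i = k' i) → f k = f k') : IsMixedProduct f := by
  classical
  refine ⟨fun i k => if i = j then f k else 1, fun i k => ?_, fun i k k' h => ?_, fun k => ?_⟩
  · dsimp only
    split_ifs <;> simp [hf]
  · dsimp only
    split_ifs with hi
    · subst hi; exact hj k k' h
    · rfl
  · simp

theorem comp_equiv {κ : Type*} [Fintype κ] {β : κ → Type*} (e : ι ≃ κ)
    {g : (∀ i, β i) → ℂ} (hg : IsMixedProduct g) :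
    IsMixedProduct fun k => g (Equiv.piCongrLeft β e k) := by
  obtain ⟨b, hb, hb', hgb⟩ := hg
  refine ⟨fun j k => b (e j) (Equiv.piCongrLeft β e k), fun j k => hb _ _, fun j k k' h => ?_,
    fun k => ?_⟩
  · refine hb' _ _ _ fun i hi => ?_
    obtain ⟨i, rfl⟩ := e.surjective i
    simpa only [Equiv.piCongrLeft_apply_apply] using h i fun h => hi (by rw [h])
  · simp only [hgb, ← e.prod_comp]

theorem option {β : Option ι → Type*} {g : (∀ o, β o) → ℂ} (hg : IsMixedProduct g) :
    ∃ (c : (∀ i, β (some i)) → ℂ) (g' : β none → (∀ i, β (some i)) → ℂ), (∀ k, ‖c k‖ ≤ 1) ∧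
      (∀ k₀, IsMixedProduct (g' k₀)) ∧
      ∀ k₀ k, g (Equiv.piOptionEquivProd.symm (k₀, k)) = c k * g' k₀ k := by
  by_cases hne : Nonempty (β none)
  · obtain ⟨d⟩ := hne
    obtain ⟨b, hb, hb', hgb⟩ := hg
    refine ⟨fun k => b none (Equiv.piOptionEquivProd.symm (d, k)),
      fun k₀ k => ∏ i, b (some i) (Equiv.piOptionEquivProd.symm (k₀, k)), fun k => hb _ _,
      fun k₀ => ⟨fun i k => b (some i) (Equiv.piOptionEquivProd.symm (k₀, k)), fun i k => hb _ _,
        fun j k k' h => hb' _ _ _ ?_, fun k => rfl⟩, fun k₀ k => ?_⟩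
    · rintro (_ | i) hi
      · rfl
      · exact h i fun h => hi (by rw [h])
    · rw [hgb, Fintype.prod_option]
      congr 1
      refine hb' _ _ _ ?_
      rintro (_ | i) hi
      · exact absurd rfl hi
      · rfl
  · exact ⟨0, 0, by simp, fun k₀ => (hne ⟨k₀⟩).elim, fun k₀ => (hne ⟨k₀⟩).elim⟩

end IsMixedProduct

end BoxProduct

/-- The Gowers-Cauchy-Schwarz inequality: a correlation with a mixed product is controlled by
the average of box products. -/
theorem norm_eavg_mixedProduct_pow_le.{u} {G : Type u} [AddCommGroup G] [Finite G]
    {ι : Type} [Fintype ι] (K : ι → AddSubgroup G) {U : Type u} [Finite U] [Nonempty U]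
    (F : U → G → ℂ) (g : U → G → (∀ i, K i) → ℂ) (hg : ∀ u x, IsMixedProduct (g u x)) :
    ‖eavg fun u => eavg fun x => eavg fun k : ∀ i, K i =>
        F u (x - ∑ i, (k i : G)) * g u x k‖ ^ 2 ^ Fintype.card ι ≤
      ‖eavg fun u => eavg fun x => eavg fun k : ∀ i, K i =>
        boxProd (F u) x fun i => (k i : G)‖ := by
  revert U
  refine Fintype.induction_empty_option (P := fun ι _ => ∀ (K : ι → AddSubgroup G) {U : Type u}
    [Finite U] [Nonempty U] (F : U → G → ℂ) (g : U → G → (∀ i, K i) → ℂ)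
    (_ : ∀ u x, IsMixedProduct (g u x)),
    ‖eavg fun u => eavg fun x => eavg fun k : ∀ i, K i =>
        F u (x - ∑ i, (k i : G)) * g u x k‖ ^ 2 ^ Fintype.card ι ≤
      ‖eavg fun u => eavg fun x => eavg fun k : ∀ i, K i =>
        boxProd (F u) x fun i => (k i : G)‖) ?_ ?_ ?_ ι K
  · intro α β _ e ih K U _ _ F g hg
    let _ := Fintype.ofEquiv β e.symm
    have h := ih (fun a => K (e a)) F
      (fun u x k => g u x (Equiv.piCongrLeft (fun b => K b) e k)) fun u x =>
        (hg u x).comp_equiv e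
    rw [Fintype.card_congr e] at h
    convert! h using 1
    · congr 3
      funext u
      congr 1
      funext x
      rw [← eavg_comp_equiv (Equiv.piCongrLeft (fun b => K b) e)]
      simp only [← e.sum_comp, Equiv.piCongrLeft_apply_apply]
    · congr 2
      funext u
      congr 1
      funext x
      rw [← eavg_comp_equiv (Equiv.piCongrLeft (fun b => K b) e)]
      simp only [← boxProd_comp_equiv e, Equiv.piCongrLeft_apply_apply]
  · intro K U _ _ F g hg
    simp only [Fintype.card_eq_zero, pow_zero, pow_one, Finset.univ_eq_empty, Finset.sum_empty,
      sub_zero, boxProd_of_isEmpty]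
    have hg₁ : ∀ u x k, g u x k = 1 := fun u x k => by
      obtain ⟨b, -, -, h⟩ := hg u x
      simp [h]
    simp only [hg₁, mul_one, le_refl]
  · intro ι _ ih K U _ _ F g hg
    choose c g' hc hg' hgc using fun u x => (hg u x).option
    have h := ih (fun i => K (some i)) (U := U × (K none × K none))
      (fun v y => F v.1 (y - v.2.1) * starRingEnd ℂ (F v.1 (y - v.2.2)))
      (fun v x k => g' v.1 x v.2.1 k * starRingEnd ℂ (g' v.1 x v.2.2 k))
      fun v x => (hg' _ _ _).mul (hg' _ _ _).conj
    have hcs := sq_norm_eavg_mul_le (α := U × G × (∀ i, K (some i)))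
      (a := fun p => c p.1 p.2.1 p.2.2) (fun p => hc _ _ _) fun p =>
        eavg fun k₀ : K none => F p.1 (p.2.1 - (k₀ + ∑ i, (p.2.2 i : G))) * g' p.1 p.2.1 k₀ p.2.2
    rw [Fintype.card_option, pow_succ', pow_mul]
    refine (pow_le_pow_left₀ (by positivity) (le_of_eq_of_le ?_ (hcs.trans_eq ?_)) _).trans
      (h.trans_eq ?_)
    · congr 2
      simp only [eavg_prod]
      congr! 4 with u x
      rw [← eavg_comp_equiv (Equiv.piOptionEquivProd (β := fun o => K o)).symm, eavg_prod,
        eavg_comm]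
      simp only [mul_eavg, hgc, Fintype.sum_option]
      congr! 4 with k k₀
      exact mul_left_comm _ _ _
    · congr 1
      simp only [eavg_mul_conj_eavg, eavg_prod]
      congr! 2 with u
      simp only [eavg_comm (α := ∀ i, K (some i))]
      rw [eavg_comm]
      refine congrArg eavg (funext fun k₀ => ?_)
      rw [eavg_comm]
      congr! 6
      simp only [map_mul, ← sub_sub, sub_right_comm]
      exact mul_mul_mul_comm _ _ _ _
    · congr 1
      simp only [eavg_prod]
      refine congrArg eavg (funext fun u => ?_)
      rw [boxAvg_option (f := F u)]
      have hs := fun (x : G) => eavg_comp_surjective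
        (AddMonoidHom.coprod (.id (K none)) (-.id (K none))) (fun w => ⟨(w, 0), by simp⟩)
        fun w : K none => eavg fun h : ∀ i, K (some i) =>
          boxProd (mulDeriv (w : G) (F u)) x fun i => (h i : G)
      simp only [← hs, eavg_prod, eavg_comm (α := G) (β := K none)]
      refine congrArg eavg (funext fun k₀ => congrArg eavg (funext fun k₁ => ?_))
      symm
      rw [← eavg_add_right (-(k₀ : G))]
      simp only [← boxProd_translate, mulDeriv]
      congr! 8 with x k y
      · abel
      · simp [sub_eq_add_neg]

open Classical in
/-- The box product with the factor at the base vertex removed. -/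
def punctBoxProd {G : Type*} [AddCommGroup G] {ι : Type*} [Finite ι] (f : G → ℂ) (x : G)
    (h : ι → G) : ℂ :=
  haveI := Fintype.ofFinite ι
  haveI : Fintype (ι → Bool) := Fintype.ofFinite _
  ∏ ε ∈ univ.erase fun _ : ι => false, conjIter (epsWt ε) (f (x + ∑ i, if ε i then h i else 0))

theorem boxProd_eq_mul_punctBoxProd {G : Type*} [AddCommGroup G] {ι : Type*} [Finite ι]
    (f : G → ℂ) (x : G) (h : ι → G) : boxProd f x h = f x * punctBoxProd f x h := by
  classical
  rw [boxProd, punctBoxProd]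
  generalize Fintype.ofFinite (ι → Bool) = inst
  rw [← Finset.mul_prod_erase univ _ (mem_univ fun _ : ι => false)]
  congr 1
  · simp [epsWt, conjIter]
  · congr!

theorem eavg_shear {G α : Type*} [AddGroup G] [Finite G] [Finite α] (σ : α → G)
    (Ψ : G → α → ℂ) :
    (eavg fun x => eavg fun k => Ψ (x - σ k) k) = eavg fun x => eavg fun k => Ψ x k := by
  rw [eavg_comm, eavg_comm Ψ]
  exact congrArg eavg (funext fun k => eavg_sub_right (σ k) fun x => Ψ x k)

theorem isMixedProduct_punctBoxProd {G : Type*} [AddCommGroup G] {ι κ : Type*} [Finite ι]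
    [Fintype κ] {K : κ → AddSubgroup G} {f : G → ℂ} (hf : ∀ y, ‖f y‖ ≤ 1) (x : G)
    {e : ι → κ} (he : Function.Injective e) :
    IsMixedProduct fun k : ∀ j, K j =>
      punctBoxProd f (x - ∑ j, (k j : G)) fun i => (k (e i) : G) := by
  classical
  refine IsMixedProduct.prod _ fun ε hε => ?_
  obtain ⟨i₀, hi₀⟩ : ∃ i, ε i = true := by
    by_contra! h
    have hε' : ε ≠ fun _ => false := by simpa using hε
    exact hε' (funext fun i => by simpa using h i)
  refine IsMixedProduct.of_independent (fun k => (norm_conjIter _ _).trans_le (hf _)) (e i₀)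
    fun k k' h => ?_
  have := Fintype.ofFinite ι
  have hk : ∀ k : ∀ j, K j, x - ∑ j, (k j : G) + ∑ i, (if ε i then (k (e i) : G) else 0) =
      x - ∑ j ∈ univ.erase (e i₀), (k j : G) +
        ∑ i ∈ univ.erase i₀, (if ε i then (k (e i) : G) else 0) := by
    intro k
    rw [← Finset.add_sum_erase _ _ (mem_univ (e i₀)), ← Finset.add_sum_erase _ _ (mem_univ i₀),
      if_pos hi₀]
    abel
  congr 2
  convert (hk k).trans (Eq.trans ?_ (hk k').symm)
  congr 1
  · congr 1
    exact Finset.sum_congr rfl fun j hj => by rw [h j (Finset.ne_of_mem_erase hj)]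
  · refine Finset.sum_congr rfl fun i hi => ?_
    rw [h (e i) (he.ne (Finset.ne_of_mem_erase hi))]

theorem norm_mulDeriv_le {G : Type*} [AddCommGroup G] {f : G → ℂ} (hf : ∀ y, ‖f y‖ ≤ 1)
    (a x : G) : ‖mulDeriv a f x‖ ≤ 1 := by
  rw [mulDeriv, norm_mul, RCLike.norm_conj]
  exact mul_le_one₀ (hf _) (norm_nonneg _) (hf _)

/-- The dual function of `f` for the box with edges in `H` and `K`. -/
def boxDual {G : Type*} [AddCommGroup G] [Finite G] {ι : Type*} [Finite ι] (H : AddSubgroup G)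
    (K : ι → AddSubgroup G) (f : G → ℂ) (x : G) : ℂ :=
  eavg fun w : H => eavg fun k : ∀ i, K i =>
    starRingEnd ℂ (f (x + w)) * punctBoxProd (mulDeriv (w : G) f) x fun i => (k i : G)

theorem boxAvg_eq_eavg_mul_boxDual {G : Type*} [AddCommGroup G] [Finite G] {ι : Type*} [Finite ι]
    (H : Option ι → AddSubgroup G) (f : G → ℂ) :
    (eavg fun x : G => eavg fun h : ∀ i, H i => boxProd f x fun i => (h i : G)) =
      eavg fun x : G => f x * boxDual (H none) (fun i => H (some i)) f x := by
  rw [boxAvg_option]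
  simp only [boxDual, mul_eavg, boxProd_eq_mul_punctBoxProd]
  simp only [mulDeriv, mul_assoc]

theorem norm_eavg_boxDual_pow_le.{u} {G : Type u} [AddCommGroup G] [Finite G] {ι κ : Type}
    [Fintype ι] [Fintype κ] (H H' : AddSubgroup G) (K : ι → AddSubgroup G)
    (K' : κ → AddSubgroup G) {f : G → ℂ} (hf : ∀ x, ‖f x‖ ≤ 1) :
    ‖eavg fun x => boxDual H K f x * starRingEnd ℂ (boxDual H' K' f x)‖ ^
        2 ^ (Fintype.card ι + Fintype.card κ) ≤
      ‖eavg fun x : G => eavg fun h : ∀ o : Option (ι ⊕ κ),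
        ↥((o.elim (H ⊔ H') (Sum.elim K K') : AddSubgroup G)) =>
          boxProd f x fun o => (h o : G)‖ := by
  have h := norm_eavg_mixedProduct_pow_le (Sum.elim K K')
    (fun (u : H × H') y => starRingEnd ℂ (f (y + u.1)) * f (y + u.2))
    (fun u x k =>
      punctBoxProd (mulDeriv (u.1 : G) f) (x - ∑ j, (k j : G)) (fun i => (k (Sum.inl i) : G)) *
      starRingEnd ℂ (punctBoxProd (mulDeriv (u.2 : G) f) (x - ∑ j, (k j : G))
        fun i => (k (Sum.inr i) : G)))
    fun u x => (isMixedProduct_punctBoxProd (norm_mulDeriv_le hf _) x Sum.inl_injective).mul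
      (isMixedProduct_punctBoxProd (norm_mulDeriv_le hf _) x Sum.inr_injective).conj
  rw [Fintype.card_sum] at h
  convert! h using 1
  · congr 2
    simp only [boxDual, eavg_mul_conj_eavg]
    rw [eavg_comm]
    refine congrArg eavg (funext fun u => ?_)
    rw [eavg_shear (fun k : ∀ j, ↥(Sum.elim K K' j : AddSubgroup G) => ∑ j, (k j : G)) fun x k =>
      starRingEnd ℂ (f (x + u.1)) * f (x + u.2) *
      (punctBoxProd (mulDeriv (u.1 : G) f) x (fun i => (k (Sum.inl i) : G)) *
      starRingEnd ℂ (punctBoxProd (mulDeriv (u.2 : G) f) x fun i => (k (Sum.inr i) : G)))]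
    refine congrArg eavg (funext fun x => ?_)
    rw [← eavg_comp_equiv (Equiv.sumPiEquivProdPi
      fun j => ↥(Sum.elim K K' j : AddSubgroup G)).symm]
    refine congrArg eavg (funext fun p => ?_)
    rw [map_mul, Complex.conj_conj]
    exact mul_mul_mul_comm _ _ _ _
  · congr 1
    rw [boxAvg_option]
    dsimp only [Option.elim]
    have hs := fun (x : G) => eavg_sub_eq_eavg_sup H H' fun w =>
      eavg fun h : ∀ j, ↥(Sum.elim K K' j : AddSubgroup G) =>
        boxProd (mulDeriv w f) x fun i => (h i : G)
    simp only [← hs]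
    rw [eavg_comm]
    refine congrArg eavg (funext fun u => ?_)
    rw [← eavg_add_right (u.2 : G)]
    simp only [← boxProd_translate, mulDeriv]
    congr! 5 with x k
    funext y
    rw [mul_comm, add_assoc, add_sub_cancel]

/-- Lemma 2.4, key concatenation lemma:
`(E_{i∈I} ‖f‖_{H_i,K_{i1},…,K_{is}}^{2^{s+1}})^{2^{2s+1}}
  ≤ E_{i,i'} ‖f‖_{K_{i1},…,K_{is},K_{i'1},…,K_{i's},H_i+H_{i'}}^{2^{2s+1}}`. -/
theorem statement4 (s : ℕ) {G : Type*} [AddCommGroup G] [Finite G]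
    {I : Type*} [Finite I] [Nonempty I]
    (H : I → AddSubgroup G) (K : I → Fin s → AddSubgroup G)
    (f : G → ℂ) (hf : ∀ x, ‖f x‖ ≤ 1) :
    (eavgR fun i : I =>
        boxNorm (fun o : Option (Fin s) => o.elim (H i) (K i)) f ^ 2 ^ (s + 1)) ^
        2 ^ (2 * s + 1) ≤
      eavgR fun ii : I × I =>
        boxNorm (fun o : Option (Fin s ⊕ Fin s) =>
            o.elim (H ii.1 ⊔ H ii.2) (Sum.elim (K ii.1) (K ii.2))) f ^ 2 ^ (2 * s + 1) := by
  have h₁ := fun i => boxNorm_option_pow (fun o : Option (Fin s) => o.elim (H i) (K i)) f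
  have h₂ := fun ii : I × I => boxNorm_option_pow (fun o : Option (Fin s ⊕ Fin s) =>
    o.elim (H ii.1 ⊔ H ii.2) (Sum.elim (K ii.1) (K ii.2))) f
  have hcard : Nat.card (Option (Fin s ⊕ Fin s)) = 2 * s + 1 := by
    simp [two_mul]
  have hcard' : Nat.card (Option (Fin s)) = s + 1 := by simp
  rw [hcard] at h₂
  rw [hcard'] at h₁
  simp only [h₁, h₂]
  have havg : (eavgR fun i : I => ‖eavg fun x : G => eavg fun h : ∀ o : Option (Fin s),
      ↥((o.elim (H i) (K i) : AddSubgroup G)) => boxProd f x fun o => (h o : G)‖) =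
      ‖eavg fun x => f x * eavg fun i => boxDual (H i) (K i) f x‖ := by
    choose r hr hr' using fun i => boxAvg_option_nonneg
      (fun o : Option (Fin s) => o.elim (H i) (K i)) f
    have hd : ∀ i, (eavg fun x => f x * boxDual (H i) (K i) f x) = r i := fun i =>
      (boxAvg_eq_eavg_mul_boxDual (fun o : Option (Fin s) => o.elim (H i) (K i)) f).symm.trans
        (hr' i)
    simp only [hr', mul_eavg]
    rw [eavg_comm]
    simp only [hd, ← ofReal_eavgR, Complex.norm_real, Real.norm_of_nonneg (hr _),
      Real.norm_of_nonneg (eavgR_nonneg hr)]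
  have hcs : (eavgR fun i : I => ‖eavg fun x : G => eavg fun h : ∀ o : Option (Fin s),
      ↥((o.elim (H i) (K i) : AddSubgroup G)) => boxProd f x fun o => (h o : G)‖) ^ 2 ≤
      eavgR fun ii : I × I => ‖eavg fun x =>
        boxDual (H ii.1) (K ii.1) f x * starRingEnd ℂ (boxDual (H ii.2) (K ii.2) f x)‖ := by
    rw [havg]
    refine (sq_norm_eavg_mul_le hf _).trans ?_
    simp only [eavg_mul_conj_eavg]
    rw [eavg_comm]
    exact norm_eavg_le _
  rw [pow_succ', pow_mul]
  refine (pow_le_pow_left₀ (by positivity) hcs _).trans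
    ((eavgR_pow_le (fun _ => norm_nonneg _) _).trans (eavgR_mono fun ii => ?_))
  have h := norm_eavg_boxDual_pow_le (H ii.1) (H ii.2) (K ii.1) (K ii.2) hf
  rwa [Fintype.card_fin, ← two_mul] at h

end
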